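/- Column-decomposition holds: for every Young diagram Y, the number T(Y) of 213-avoiding transversals satisfies T(Y) = T(Y'_c) + T(Y''_c). -/

import Mathlib

/-- A Young diagram of size `n` (coordinates from the bottom-left, as in the paper):
`b i` is the length of the `i`-th row counted from the bottom, for `i < n`.
Rows get longer going up (top row is the largest), the staircase
`Y(n, n-1, ..., 1)` is contained (`i < b i`), and there are `n` columns (`b i ≤ n`). -/
def IsYoungShape (n : ℕ) (b : ℕ → ℕ) : Prop :=
  (∀ i j : ℕ, i ≤ j → j < n → b i ≤ b j) ∧ ∀ i : ℕ, i < n → i < b i ∧ b i ≤ n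

/-- A transversal of the shape `b`, encoded as a permutation sending each column `i`
(from the left) to the row `π i` (from the bottom) of the unique 1 in that column:
every cell `(column i, row π i)` must lie inside the diagram. -/
def IsTransversal (n : ℕ) (b : ℕ → ℕ) (π : Equiv.Perm (Fin n)) : Prop :=
  ∀ i : Fin n, (i : ℕ) < b (π i)

/-- The transversal `π` of the shape `b` contains the pattern `τ`: some `k` of its 1's
form a submatrix of the diagram (all crossing cells inside the diagram) identical to the
permutation matrix of `τ`. -/
def ShapeContains (n : ℕ) (b : ℕ → ℕ) {k : ℕ} (π : Fin n → Fin n) (τ : Fin k → Fin k) : Prop :=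
  ∃ f : Fin k ↪o Fin n,
    (∀ a c : Fin k, τ a < τ c ↔ π (f a) < π (f c)) ∧
    ∀ a c : Fin k, (f a : ℕ) < b (π (f c))

/-- The number of transversals of the shape `b` avoiding the pattern `τ`,
i.e. `|S_Y(τ)|`. -/
noncomputable def shapeAvoidCard (n : ℕ) (b : ℕ → ℕ) {k : ℕ} (τ : Fin k → Fin k) : ℕ :=
  Nat.card {π : Equiv.Perm (Fin n) // IsTransversal n b π ∧ ¬ ShapeContains n b ⇑π τ}

/-- Shape-Wilf-equivalence: equally many avoiders on every Young diagram. -/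
def ShapeWilfEquiv {k l : ℕ} (τ : Fin k → Fin k) (σ : Fin l → Fin l) : Prop :=
  ∀ (n : ℕ) (b : ℕ → ℕ), IsYoungShape n b → shapeAvoidCard n b τ = shapeAvoidCard n b σ

/-- `T Y`: the number of 213-avoiding transversals of the Young diagram `Y`
(the pattern 213 written 0-indexed is `![1,0,2]`). -/
noncomputable def T (n : ℕ) (b : ℕ → ℕ) : ℕ :=
  shapeAvoidCard n b (![1,0,2] : Fin 3 → Fin 3)

/-- The size `k` of the subdiagram `A_C` associated to the bottom cell `C` in column `c`
(0-indexed) of the Young diagram `b` of size `n`: the 45° ray drawn north-east from the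
top-right corner of `C` in the reduction `Y/C` first meets the border of `Y/C` after
passing through `k` cells.  (`k = 0`, i.e. `A_C = ∅`, exactly when the first diagonal
cell is already missing.) -/
noncomputable def rdK (n : ℕ) (b : ℕ → ℕ) (c : ℕ) : ℕ :=
  sInf {s : ℕ | (s = 0 ∧ (n ≤ 1 ∨ b 1 ≤ c + 1)) ∨ (1 ≤ s ∧ b s ≤ c + s + 1)}

/-- The row lengths (from the bottom) of the Young diagram `A_C` for the bottom cell in
column `c`: it occupies rows `1..k` of `Y` and the `k` columns `c+1, ..., c+k`. -/
noncomputable def rdA (n : ℕ) (b : ℕ → ℕ) (c : ℕ) (t : ℕ) : ℕ :=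
  min (rdK n b c) (b (t + 1) - (c + 1))

/-- The row lengths (from the bottom) of the Young diagram `B_C` for the bottom cell in
column `c`: what remains of `Y/C` after deleting the rows and columns of `A_C`;
it has size `n - 1 - k`. -/
noncomputable def rdB (n : ℕ) (b : ℕ → ℕ) (c : ℕ) (r : ℕ) : ℕ :=
  b (rdK n b c + 1 + r) - 1 - rdK n b c

/-- The transpose of the Young diagram `b` of size `n` (reflection across the main
diagonal of the diagram): row `r` from the bottom of the transpose has as many cells
as column `n-1-r` (from the left) of `b`. -/
def transposeShape (n : ℕ) (b : ℕ → ℕ) (r : ℕ) : ℕ :=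
  ((Finset.range n).filter (fun i => n - 1 - r < b i)).card

/-- The row (from the bottom) of the right corner cell `C_t` of `b`: the lowest row
reaching the rightmost column. -/
noncomputable def ccRow (n : ℕ) (b : ℕ → ℕ) : ℕ :=
  sInf {r : ℕ | n ≤ b r}

/-- Column-deletion `Y'_c`: the diagram `Y` with its right corner cell `C_t` deleted. -/
noncomputable def colDel (n : ℕ) (b : ℕ → ℕ) (i : ℕ) : ℕ :=
  if i = ccRow n b then n - 1 else b i

/-- `T(Y''_c)`: the value of `T` on the column-decomposition summand `Y''_c` of `Y`
associated with the cell `C_{t-1}` directly above the right corner, defined by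
transposing the row-decomposition construction: `Y''_c = ((Yᵗ)''_r)ᵗ`, so
`T(Y''_c) = T(A^t) * T(B^t)` for the cross-product `A × B = (Yᵗ)''_r`. -/
noncomputable def cdTermT (n : ℕ) (b : ℕ → ℕ) : ℕ :=
  let bt := transposeShape n b
  let c := bt 0 - 2
  let K := rdK n bt c
  T K (transposeShape K (rdA n bt c)) *
    T (n - 1 - K) (transposeShape (n - 1 - K) (rdB n bt c))

/-- Avoiders of `213` on the shape `b`, encoded as functions `ℕ → ℕ` that send every column
`i < n` to its row and take the value `n` elsewhere. -/
structure IsAvoider (n : ℕ) (b f : ℕ → ℕ) : Prop where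
  out : ∀ i, n ≤ i → f i = n
  lt : ∀ i, i < n → f i < n
  inj : ∀ i j, i < n → j < n → f i = f j → i = j
  mem : ∀ i, i < n → i < b (f i)
  avoid : ∀ x w z, x < w → w < z → z < n → f w < f x → f x < f z → z < b (f w) → False

theorem shapeContains_213_iff {n : ℕ} {b : ℕ → ℕ} (hb : ∀ i j : ℕ, i ≤ j → j < n → b i ≤ b j)
    (π : Fin n → Fin n) :
    ShapeContains n b π (![1, 0, 2] : Fin 3 → Fin 3) ↔
      ∃ x w z : Fin n, x < w ∧ w < z ∧ π w < π x ∧ π x < π z ∧ (z : ℕ) < b (π w) := by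
  constructor
  · rintro ⟨f, h1, h2⟩
    refine ⟨f 0, f 1, f 2, f.strictMono (by decide), f.strictMono (by decide),
      (h1 1 0).1 (by decide), (h1 0 2).1 (by decide), h2 2 1⟩
  · rintro ⟨x, w, z, hxw, hwz, h1, h2, h3⟩
    have hm : StrictMono ![x, w, z] := by
      intro a c hac
      fin_cases a <;> fin_cases c <;> simp_all [lt_trans hxw hwz]
    have h4 : b (π w) ≤ b (π x) := hb _ _ (Fin.le_def.1 h1.le) (π x).2
    have h5 : b (π w) ≤ b (π z) := hb _ _ (Fin.le_def.1 (h1.trans h2).le) (π z).2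
    have h8 := h1.trans h2
    refine ⟨OrderEmbedding.ofStrictMono _ hm, ?_, ?_⟩
    · intro a c
      fin_cases a <;> fin_cases c <;> simp [h1, h2, h1.le, h2.le, h8, h8.le]
    · intro a c
      fin_cases a <;> fin_cases c <;> simp <;> omega

/-- Extension of a map on `Fin n` to `ℕ` by the value `n`. -/
def extendNat (n : ℕ) (π : Fin n → Fin n) (i : ℕ) : ℕ :=
  if h : i < n then π ⟨i, h⟩ else n

theorem extendNat_coe {n : ℕ} (π : Fin n → Fin n) (i : Fin n) : extendNat n π i = π i := by
  simp [extendNat]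

theorem isAvoider_extendNat_iff {n : ℕ} {b : ℕ → ℕ}
    (hb : ∀ i j : ℕ, i ≤ j → j < n → b i ≤ b j) (π : Equiv.Perm (Fin n)) :
    IsAvoider n b (extendNat n π) ↔
      IsTransversal n b π ∧ ¬ ShapeContains n b ⇑π (![1, 0, 2] : Fin 3 → Fin 3) := by
  rw [shapeContains_213_iff hb]
  constructor
  · intro h
    refine ⟨fun i => ?_, ?_⟩
    · simpa [extendNat_coe] using h.mem i i.2
    · rintro ⟨x, w, z, hxw, hwz, h1, h2, h3⟩
      refine h.avoid x w z hxw hwz z.2 ?_ ?_ ?_ <;> simpa [extendNat_coe]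
  · rintro ⟨h1, h2⟩
    refine ⟨fun i hi => by simp [extendNat, hi], fun i hi => by simp [extendNat, hi], ?_, ?_, ?_⟩
    · intro i j hi hj h
      simpa [extendNat, hi, hj, Fin.val_inj] using h
    · intro i hi
      simpa [extendNat, hi] using h1 ⟨i, hi⟩
    · intro x w z hxw hwz hz h3 h4 h5
      have hw := hwz.trans hz
      have hx := hxw.trans hw
      simp only [extendNat, hx, hw, hz, dite_true] at h3 h4 h5
      exact h2 ⟨⟨x, hx⟩, ⟨w, hw⟩, ⟨z, hz⟩, hxw, hwz, h3, h4, h5⟩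

/-- Avoiding transversals correspond to `IsAvoider` functions. -/
theorem bijective_extendNat {n : ℕ} {b : ℕ → ℕ}
    (hb : ∀ i j : ℕ, i ≤ j → j < n → b i ≤ b j) :
    Function.Bijective (fun π : {π : Equiv.Perm (Fin n) //
      IsTransversal n b π ∧ ¬ ShapeContains n b ⇑π (![1, 0, 2] : Fin 3 → Fin 3)} =>
        (⟨extendNat n π.1, (isAvoider_extendNat_iff hb π.1).2 π.2⟩ : {f | IsAvoider n b f})) := by
  constructor
  · rintro ⟨π, hπ⟩ ⟨ρ, hρ⟩ h
    have h' : extendNat n π = extendNat n ρ := congrArg Subtype.val h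
    ext i
    have := congrFun h' i
    simpa [extendNat_coe] using this
  · rintro ⟨f, hf : IsAvoider n b f⟩
    have hinj : Function.Injective (fun i : Fin n => (⟨f i, hf.lt i i.2⟩ : Fin n)) := by
      intro i j hij
      exact Fin.ext (hf.inj i j i.2 j.2 (congrArg Fin.val hij))
    have he : extendNat n (Equiv.ofBijective _ (Finite.injective_iff_bijective.1 hinj)) = f := by
      funext i
      by_cases hi : i < n
      · simp [extendNat, hi]
      · simp [extendNat, hi, hf.out i (not_lt.1 hi)]
    have hf' := hf
    rw [← he] at hf'
    exact ⟨⟨_, (isAvoider_extendNat_iff hb _).1 hf'⟩, Subtype.ext he⟩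

theorem finite_isAvoider {n : ℕ} {b : ℕ → ℕ} (hb : ∀ i j : ℕ, i ≤ j → j < n → b i ≤ b j) :
    {f | IsAvoider n b f}.Finite :=
  Set.finite_coe_iff.1 (Finite.of_surjective _ (bijective_extendNat hb).2)

theorem T_eq_ncard {n : ℕ} {b : ℕ → ℕ} (hb : ∀ i j : ℕ, i ≤ j → j < n → b i ≤ b j) :
    T n b = {f | IsAvoider n b f}.ncard :=
  Nat.card_eq_of_bijective _ (bijective_extendNat hb)

theorem T_congr {n : ℕ} {b b' : ℕ → ℕ} (h : ∀ i, i < n → b i = b' i) : T n b = T n b' := by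
  have h' : ∀ i : Fin n, b i = b' i := fun i => h i i.2
  simp only [T, shapeAvoidCard, IsTransversal, ShapeContains, h']

theorem exists_of_mapsTo_Ico {n a b c d : ℕ} {f : ℕ → ℕ}
    (hinj : ∀ i j, i < n → j < n → f i = f j → i = j) (hd : d ≤ n)
    (hmap : ∀ i, c ≤ i → i < d → a ≤ f i ∧ f i < b) (hcard : b - a ≤ d - c)
    {u : ℕ} (hau : a ≤ u) (hub : u < b) : ∃ i, c ≤ i ∧ i < d ∧ f i = u := by
  have hsub : (Finset.Ico c d).image f ⊆ Finset.Ico a b := by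
    intro x hx
    simp only [Finset.mem_image, Finset.mem_Ico] at hx ⊢
    obtain ⟨i, hi, rfl⟩ := hx
    exact hmap i hi.1 hi.2
  have hc : ((Finset.Ico c d).image f).card = d - c := by
    rw [Finset.card_image_of_injOn, Nat.card_Ico]
    intro i hi j hj
    simp only [Finset.coe_Ico, Set.mem_Ico] at hi hj
    exact hinj i j (by omega) (by omega)
  have := Finset.eq_of_subset_of_card_le hsub (by rw [hc, Nat.card_Ico]; exact hcard)
  have hu : u ∈ (Finset.Ico c d).image f := by rw [this]; simp [hau, hub]
  simp only [Finset.mem_image, Finset.mem_Ico] at hu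
  obtain ⟨i, hi, rfl⟩ := hu
  exact ⟨i, hi.1, hi.2, rfl⟩

theorem sub_le_sub_of_forall_exists {a b c d : ℕ} {f : ℕ → ℕ}
    (h : ∀ u, a ≤ u → u < b → ∃ i, c ≤ i ∧ i < d ∧ f i = u) : b - a ≤ d - c := by
  have hsub : Finset.Ico a b ⊆ (Finset.Ico c d).image f := by
    intro u hu
    simp only [Finset.mem_image, Finset.mem_Ico] at hu ⊢
    obtain ⟨i, h1, h2, h3⟩ := h u hu.1 hu.2
    exact ⟨i, ⟨h1, h2⟩, h3⟩
  have := (Finset.card_le_card hsub).trans Finset.card_image_le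
  simpa using this

theorem exists_eq_of_injOn {n : ℕ} {f : ℕ → ℕ} (hlt : ∀ i, i < n → f i < n)
    (hinj : ∀ i j, i < n → j < n → f i = f j → i = j) {u : ℕ} (hu : u < n) :
    ∃ i, i < n ∧ f i = u := by
  obtain ⟨i, -, h2, h3⟩ := exists_of_mapsTo_Ico (a := 0) (b := n) (c := 0) hinj le_rfl
    (fun i _ hi => ⟨Nat.zero_le _, hlt i hi⟩) le_rfl (Nat.zero_le u) hu
  exact ⟨i, h2, h3⟩

/-- A Young diagram with `m + 1` columns whose right corner lies in row `r`, and whose diagonal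
drawn southwest from the cell above the corner passes through `k` cells. -/
structure IsCornerShape (m r k : ℕ) (b : ℕ → ℕ) : Prop where
  mono : ∀ i j : ℕ, i ≤ j → j < m + 1 → b i ≤ b j
  r_lt : r < m
  full : ∀ j, r ≤ j → j ≤ m → b j = m + 1
  le : ∀ j, j < r → b j ≤ m
  one_le : 1 ≤ k
  k_le : k ≤ r + 1
  diag : ∀ s, 1 ≤ s → s < k → m + 1 ≤ b (r - s) + s
  diag_end : ∀ j, j + k ≤ r → b j + k ≤ m

theorem IsCornerShape.le_add {m r k s : ℕ} {b : ℕ → ℕ} (hC : IsCornerShape m r k b)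
    (hs : s < k) : m + 1 ≤ b (r - s) + s := by
  rcases Nat.eq_zero_or_pos s with rfl | h
  · simp [hC.full r le_rfl hC.r_lt.le]
  · exact hC.diag s h hs

/-- Avoiders with the last column in row `r + 1` and an entry above row `r + 1` among the
preceding `k` columns. -/
structure IsNonsplit (m r k : ℕ) (b f : ℕ → ℕ) : Prop where
  av : IsAvoider (m + 1) b f
  last : f m = r + 1
  ex : ∃ i, m - k ≤ i ∧ i < m ∧ r + 1 < f i

/-- Transversals all of whose `213` patterns use the corner cell `(m, r)` as their bottom right
cell, and which have at least one such pattern. -/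
structure IsCornerOnly (m r : ℕ) (b f : ℕ → ℕ) : Prop where
  out : ∀ i, m + 1 ≤ i → f i = m + 1
  lt : ∀ i, i < m + 1 → f i < m + 1
  inj : ∀ i j, i < m + 1 → j < m + 1 → f i = f j → i = j
  mem : ∀ i, i < m + 1 → i < b (f i)
  avoid : ∀ x w z, x < w → w < z → z < m → f w < f x → f x < f z → z < b (f w) → False
  avoid_last : ∀ x w, x < w → w < m → r < f w → f w < f x → f x < f m → False
  wit : ∃ x w, x < w ∧ w < m ∧ f w = r ∧ r < f x ∧ f x < f m

theorem isCornerOnly_iff {m r k : ℕ} {b b' f : ℕ → ℕ} (hC : IsCornerShape m r k b)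
    (hb' : ∀ j, b' j = if j = r then m else b j) :
    IsCornerOnly m r b f ↔ IsAvoider (m + 1) b' f ∧ ¬ IsAvoider (m + 1) b f := by
  have hr := hC.r_lt
  constructor
  · intro h
    obtain ⟨x, w, hxw, hwm, h1, h2, h3⟩ := h.wit
    refine ⟨⟨h.out, h.lt, h.inj, ?_, ?_⟩, ?_⟩
    · intro i hi
      rw [hb']
      split_ifs with hfi
      · have : i ≠ m := by rintro rfl; omega
        omega
      · exact h.mem i hi
    · intro x' w' z' hx hw hz h4 h5 h6
      rw [hb'] at h6
      by_cases hz' : z' < m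
      · refine h.avoid x' w' z' hx hw hz' h4 h5 ?_
        split_ifs at h6 with h7
        · rw [h7, hC.full r le_rfl hr.le]; omega
        · exact h6
      · obtain rfl : z' = m := by omega
        split_ifs at h6 with h7
        · omega
        · refine h.avoid_last x' w' hx hw ?_ h4 h5
          by_contra hlt
          have := hC.le (f w') (by omega)
          omega
    · intro h'
      refine h'.avoid x w m hxw hwm (by omega) (by omega) h3 ?_
      rw [h1, hC.full r le_rfl hr.le]
      omega
  · rintro ⟨h, h'⟩
    have hmem : ∀ i, i < m + 1 → i < b (f i) := by
      intro i hi
      have := h.mem i hi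
      rw [hb'] at this
      split_ifs at this with h1
      · rw [h1, hC.full r le_rfl hr.le]; exact hi
      · exact this
    have hav : ∀ x w z, x < w → w < z → z < m + 1 → f w < f x → f x < f z → z < b (f w) →
        z = m ∧ f w = r := by
      intro x w z h1 h2 h3 h4 h5 h6
      have := h.avoid x w z h1 h2 h3 h4 h5
      rw [hb'] at this
      split_ifs at this with h7
      · exact ⟨by by_contra hz; exact this (by omega), h7⟩
      · exact (this h6).elim
    refine ⟨h.out, h.lt, h.inj, hmem, ?_, ?_, ?_⟩
    · intro x w z h1 h2 h3 h4 h5 h6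
      have := hav x w z h1 h2 (by omega) h4 h5 h6
      omega
    · intro x w h1 h2 h3 h4 h5
      have h7 := h.lt w (by omega)
      have := hav x w m h1 h2 (by omega) h4 h5 (by rw [hC.full (f w) h3.le (by omega)]; omega)
      omega
    · by_contra hno
      refine h' ⟨h.out, h.lt, h.inj, hmem, ?_⟩
      intro x w z h1 h2 h3 h4 h5 h6
      obtain ⟨rfl, h8⟩ := hav x w z h1 h2 h3 h4 h5 h6
      exact hno ⟨x, w, h1, h2, h8, by omega, h5⟩

theorem IsCornerOnly.lt_of_lt {m r k : ℕ} {b f : ℕ → ℕ} (hC : IsCornerShape m r k b)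
    (h : IsCornerOnly m r b f) {y i : ℕ} (hy : y < m) (hfy : f y = r) (hi : i < m)
    (hfi : r < f i) : i < y := by
  obtain ⟨x, w, hxw, hwm, h1, h2, h3⟩ := h.wit
  obtain rfl := h.inj w y (by omega) (by omega) (by omega)
  by_contra hle
  have hne : i ≠ w := by rintro rfl; omega
  have hne' : f i ≠ f x := fun he => by
    have := h.inj i x (by omega) (by omega) he
    omega
  by_cases hlt : f x < f i
  · refine h.avoid x w i hxw (by omega) hi (by omega) hlt ?_
    rw [h1, hC.full r le_rfl hC.r_lt.le]
    omega
  · exact h.avoid_last x i (by omega) hi hfi (by omega) h3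

/-- `y` is the last column before column `m` with an entry above row `r + 1`, and `v` is the
largest entry up to `r` before column `y`. -/
structure IsMark (m r : ℕ) (f : ℕ → ℕ) (y v : ℕ) : Prop where
  lt : y < m
  large : r + 1 < f y
  after : ∀ i, y < i → i < m → f i ≤ r
  le : v ≤ r
  ex : ∃ q, q < y ∧ f q = v
  max : ∀ i, i < y → f i ≤ r → f i ≤ v

/-- The column `y` that an `IsMark` column becomes after rotating entries. -/
structure IsComark (m r k : ℕ) (b f : ℕ → ℕ) (y : ℕ) : Prop where
  ge : m - k ≤ y
  lt : y < m
  le : f y ≤ r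
  before : ∀ i, i < m → r < f i → i < y
  max : ∀ i, i < y → f i ≤ r → f i < f y
  row : ∀ q i, f q = r + 1 → q < i → i < y → f i ≤ r → b (f i) ≤ y

theorem IsMark.unique {m r : ℕ} {f : ℕ → ℕ} {y v y' v' : ℕ}
    (h : IsMark m r f y v) (h' : IsMark m r f y' v') : y = y' ∧ v = v' := by
  have hy : y = y' := by
    rcases lt_trichotomy y y' with hlt | rfl | hlt
    · have := h.after y' hlt h'.lt
      have := h'.large
      omega
    · rfl
    · have := h'.after y hlt h.lt
      have := h.large
      omega
  subst hy
  obtain ⟨q, hq, rfl⟩ := h.ex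
  obtain ⟨q', hq', rfl⟩ := h'.ex
  exact ⟨rfl, le_antisymm (h'.max q hq h.le) (h.max q' hq' h'.le)⟩

theorem IsMark.lt_row {m r k : ℕ} {b f : ℕ → ℕ} (hC : IsCornerShape m r k b)
    (h : IsNonsplit m r k b f) {y v : ℕ} (hM : IsMark m r f y v) : m - k ≤ y ∧ y < b v := by
  obtain ⟨i, hi1, hi2, hi3⟩ := h.ex
  have hge : m - k ≤ y := by
    by_contra hlt
    have := hM.after i (by omega) hi2
    omega
  refine ⟨hge, ?_⟩
  have hlt := hM.lt
  have hr := hC.r_lt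
  by_contra hb
  have hdiag := hC.le_add (s := m - y - 1) (by omega)
  have hv : v < r - (m - y - 1) := by
    by_contra hv
    have := hC.mono (r - (m - y - 1)) v (by omega) (by have := hM.le; omega)
    omega
  have := sub_le_sub_of_forall_exists (a := r - (m - y - 1)) (b := r + 1) (c := y + 1) (d := m)
    (f := f) (by
      intro u hu1 hu2
      obtain ⟨j, hj1, hj2⟩ := exists_eq_of_injOn h.av.lt h.av.inj (u := u) (by omega)
      have h1 := hM.max j
      have h2 := hM.large
      have h3 : j ≠ y := by rintro rfl; omega
      have h4 : j ≠ m := by rintro rfl; have := h.last; omega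
      exact ⟨j, by omega, by omega, hj2⟩)
  omega

theorem IsNonsplit.exists_isMark {m r k : ℕ} {b f : ℕ → ℕ} (hC : IsCornerShape m r k b)
    (h : IsNonsplit m r k b f) : ∃ y v, IsMark m r f y v := by
  obtain ⟨i, hi1, hi2, hi3⟩ := h.ex
  have hk := hC.k_le
  have hr := hC.r_lt
  have hex : ∃ s, s < m ∧ r + 1 < f (m - 1 - s) :=
    ⟨m - 1 - i, by omega, by rwa [show m - 1 - (m - 1 - i) = i by omega]⟩
  obtain ⟨hs1, hs2⟩ := Nat.find_spec hex
  set s := Nat.find hex with hs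
  have hsi : s ≤ m - 1 - i := by
    rw [hs]
    exact Nat.find_min' hex ⟨by omega, by rwa [show m - 1 - (m - 1 - i) = i by omega]⟩
  have hafter : ∀ j, m - 1 - s < j → j < m → f j ≤ r := by
    intro j hj1 hj2
    by_contra hj
    have hne : f j ≠ r + 1 := fun he => by
      have := h.av.inj j m (by omega) (by omega) (by rw [he, h.last])
      omega
    refine Nat.find_min hex (m := m - 1 - j) (by omega) ⟨by omega, ?_⟩
    rw [show m - 1 - (m - 1 - j) = j by omega]
    omega
  have hcand : ((Finset.range (m - 1 - s)).filter (fun j => f j ≤ r)).Nonempty := by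
    by_contra hno
    rw [Finset.not_nonempty_iff_eq_empty, Finset.filter_eq_empty_iff] at hno
    have := sub_le_sub_of_forall_exists (a := r - s) (b := r + 1) (c := m - s) (d := m)
      (f := f) (by
        intro u hu1 hu2
        obtain ⟨j, hj1, hj2⟩ := exists_eq_of_injOn h.av.lt h.av.inj (u := u) (by omega)
        have h1 : ¬ j < m - 1 - s := fun hlt => hno (Finset.mem_range.2 hlt) (by omega)
        have h3 : j ≠ m - 1 - s := by rintro rfl; omega
        have h4 : j ≠ m := by rintro rfl; have := h.last; omega
        exact ⟨j, by omega, by omega, hj2⟩)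
    omega
  obtain ⟨q, hq, hmax⟩ := Finset.exists_max_image _ f hcand
  simp only [Finset.mem_filter, Finset.mem_range] at hq hmax
  exact ⟨m - 1 - s, f q, by omega, hs2, hafter, hq.2, ⟨q, hq.1, rfl⟩,
    fun j hj1 hj2 => hmax j ⟨hj1, hj2⟩⟩

/-- The cyclic permutation `a ↦ p ↦ v ↦ a`. -/
def rotate3 (a p v x : ℕ) : ℕ :=
  if x = a then p else if x = p then v else if x = v then a else x

theorem rotate3_rotate3 {a p v : ℕ} (h1 : a ≠ p) (h2 : p ≠ v) (h3 : a ≠ v) (x : ℕ) :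
    rotate3 p a v (rotate3 a p v x) = x := by
  grind [rotate3]

theorem rotate3_injective {a p v : ℕ} (h1 : a ≠ p) (h2 : p ≠ v) (h3 : a ≠ v) :
    Function.Injective (rotate3 a p v) :=
  Function.LeftInverse.injective (rotate3_rotate3 h1 h2 h3)

theorem isCornerOnly_rotate {m r k : ℕ} {b f : ℕ → ℕ} (hC : IsCornerShape m r k b)
    (h : IsNonsplit m r k b f) {y v : ℕ} (hM : IsMark m r f y v) :
    IsCornerOnly m r b (fun i => rotate3 (r + 1) (f y) v (f i)) ∧
      IsComark m r k b (fun i => rotate3 (r + 1) (f y) v (f i)) y := by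
  obtain ⟨hge, hrow⟩ := hM.lt_row hC h
  obtain ⟨hym, hlarge, hafter, hvr, ⟨q, hqy, hfq⟩, hmax⟩ := hM
  have hlast := h.last
  have hav := h.av.avoid
  have hlt := h.av.lt
  have hinj := h.av.inj
  have hfy := hlt y (by omega)
  have hfull : ∀ i j, r ≤ j → j ≤ m → i ≤ m → i < b j := fun i j h1 h2 h3 => by
    rw [hC.full j h1 h2]; omega
  set g : ℕ → ℕ := fun i => rotate3 (r + 1) (f y) v (f i) with hg
  have hgm : g m = f y := by simp [hg, rotate3, hlast]
  have hgy : g y = v := by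
    simp only [hg, rotate3]
    rw [if_neg (show f y ≠ r + 1 by omega), if_pos trivial]
  have hgq : g q = r + 1 := by
    simp only [hg, rotate3]
    rw [if_neg (by omega), if_neg (by omega), if_pos hfq]
  have hgi : ∀ i, i ≤ m → i ≠ m → i ≠ y → i ≠ q →
      g i = f i ∧ f i ≠ r + 1 ∧ f i ≠ f y ∧ f i ≠ v := by
    intro i hi h1 h2 h3
    have h4 : f i ≠ r + 1 := fun he => h1 (hinj i m (by omega) (by omega) (by omega))
    have h5 : f i ≠ f y := fun he => h2 (hinj i y (by omega) (by omega) he)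
    have h6 : f i ≠ v := fun he => h3 (hinj i q (by omega) (by omega) (by omega))
    simp [hg, rotate3, h4, h5, h6]
  have hcase : ∀ i, i ≤ m → (i = m ∧ g i = f y) ∨ (i = y ∧ g i = v) ∨ (i = q ∧ g i = r + 1) ∨
      (i ≠ m ∧ i ≠ y ∧ i ≠ q ∧ g i = f i ∧ f i ≠ r + 1 ∧ f i ≠ f y ∧ f i ≠ v) := by
    intro i hi
    by_cases h1 : i = m
    · left; subst h1; exact ⟨rfl, hgm⟩
    by_cases h2 : i = y
    · right; left; subst h2; exact ⟨rfl, hgy⟩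
    by_cases h3 : i = q
    · right; right; left; subst h3; exact ⟨rfl, hgq⟩
    obtain ⟨h4, h5, h6, h7⟩ := hgi i hi h1 h2 h3
    exact Or.inr (Or.inr (Or.inr ⟨h1, h2, h3, h4, h5, h6, h7⟩))
  have hglt : ∀ i, i < m + 1 → g i < m + 1 := by
    intro i hi
    have := hlt i hi
    rcases hcase i (by omega) with h1 | h1 | h1 | h1 <;> omega
  refine ⟨⟨?_, hglt, ?_, ?_, ?_, ?_, ?_⟩, ⟨hge, hym, by omega, ?_, ?_, ?_⟩⟩
  · intro i hi
    simp only [hg, rotate3, h.av.out i hi]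
    rw [if_neg (by omega), if_neg (by omega), if_neg (by omega)]
  · intro i j hi hj hij
    exact hinj i j hi hj (rotate3_injective (by omega) (by omega) (by omega) hij)
  · intro i hi
    rcases hcase i (by omega) with ⟨h1, h2⟩ | ⟨h1, h2⟩ | ⟨h1, h2⟩ | ⟨h1, h2, h3, h4, h5⟩
    · rw [h2]; exact hfull _ _ (by omega) (by omega) (by omega)
    · rw [h2, h1]; exact hrow
    · rw [h2]; exact hfull _ _ (by omega) (by omega) (by omega)
    · rw [h4]; exact h.av.mem i hi
  · intro x w z hxw hwz hz h1 h2 h3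
    have hmx := hmax x
    have hmw := hmax w
    have haz := hafter z
    rcases hcase w (by omega) with ⟨w1, w2⟩ | ⟨w1, w2⟩ | ⟨w1, w2⟩ | ⟨w0, w1, w2, w3, w4⟩
    · omega
    · rcases hcase x (by omega) with x1 | x1 | x1 | x1 <;>
        rcases hcase z (by omega) with z1 | z1 | z1 | z1 <;> omega
    · rcases hcase x (by omega) with x1 | x1 | x1 | x1 <;>
        rcases hcase z (by omega) with z1 | z1 | z1 | z1 <;> try omega
      exact hav x q z (by omega) (by omega) (by omega) (by omega) (by omega) (by rw [hfq]; omega)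
    · rw [w3] at h1 h3
      rcases hcase x (by omega) with x1 | x1 | x1 | x1
      · omega
      · rcases hcase z (by omega) with z1 | z1 | z1 | z1 <;> try omega
        exact hav q w z (by omega) (by omega) (by omega) (by omega) (by omega) h3
      · rcases hcase z (by omega) with z1 | z1 | z1 | z1 <;> try omega
        exact hav q w z (by omega) (by omega) (by omega) (by omega) (by omega) h3
      · rcases hcase z (by omega) with z1 | z1 | z1 | z1
        · omega
        · obtain ⟨rfl, z2⟩ := z1
          exact hav x w z (by omega) (by omega) (by omega) (by omega) (by omega) h3
        · obtain ⟨rfl, z2⟩ := z1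
          exact hav x w z (by omega) (by omega) (by omega) (by omega) (by omega) h3
        · exact hav x w z (by omega) (by omega) (by omega) (by omega) (by omega) h3
  · intro x w hxw hwm h1 h2 h3
    have haw := hafter w
    rcases hcase x (by omega) with x1 | x1 | x1 | x1 <;>
      rcases hcase w (by omega) with w1 | w1 | w1 | w1 <;> try omega
    · refine hav x q y (by omega) hqy (by omega) (by omega) (by omega) (by rw [hfq]; omega)
    · refine hav x w y (by omega) (by omega) (by omega) (by omega) (by omega)
        (hfull _ _ (by omega) (by omega) (by omega))
  · by_cases hv : v = r
    · exact ⟨q, y, hqy, hym, by omega, by omega, by omega⟩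
    · obtain ⟨j, hj1, hj2⟩ := exists_eq_of_injOn h.av.lt h.av.inj (u := r) (by omega)
      have := hmax j
      rcases hcase j (by omega) with j1 | j1 | j1 | j1
      · obtain ⟨rfl, j2⟩ := j1; omega
      · obtain ⟨rfl, j2⟩ := j1; omega
      · obtain ⟨rfl, j2⟩ := j1; omega
      · exact ⟨q, j, by omega, by omega, by omega, by omega, by omega⟩
  · intro i hi hgi'
    have := hafter i
    rcases hcase i (by omega) with i1 | i1 | i1 | i1 <;> omega
  · intro i hi hgi'
    have := hmax i hi
    rcases hcase i (by omega) with i1 | i1 | i1 | i1 <;> omega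
  · intro q' i hq' hqi hi hgi'
    have hqq : q' = q := by
      rcases hcase q' (by omega) with i1 | i1 | i1 | i1 <;> omega
    subst hqq
    have := hmax i hi
    by_contra hlt'
    rcases hcase i (by omega) with i1 | i1 | i1 | i1 <;> try omega
    rw [i1.2.2.2.1] at hlt'
    exact hav q' i y hqi hi (by omega) (by omega) (by omega) (by omega)

theorem IsCornerOnly.exists_isComark {m r k : ℕ} {b f : ℕ → ℕ} (hC : IsCornerShape m r k b)
    (h : IsCornerOnly m r b f) : ∃ y, IsComark m r k b f y := by
  obtain ⟨x, y₀, hxy₀, hy₀m, hy₀, hx1, hx2⟩ := h.wit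
  have hk1 := hC.one_le
  have hfull : ∀ i j, r ≤ j → j ≤ m → i ≤ m → i < b j := fun i j h1 h2 h3 => by
    rw [hC.full j h1 h2]; omega
  by_cases hd : ∃ i, m - k ≤ i ∧ i < m ∧ r < f i
  · obtain ⟨d, hd1, hd2, hd3⟩ := hd
    have hex : ∃ y, y < m ∧ f y ≤ r ∧ (∀ i, i < m → r < f i → i < y) ∧
        ∀ i, i < y → f i ≤ r → f i < f y := by
      refine ⟨y₀, hy₀m, hy₀.le, fun i hi hfi => h.lt_of_lt hC hy₀m hy₀ hi hfi, ?_⟩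
      intro i hi hfi
      have : f i ≠ f y₀ := fun he => by
        have := h.inj i y₀ (by omega) (by omega) he
        omega
      omega
    obtain ⟨hy1, hy2, hy3, hy4⟩ := Nat.find_spec hex
    have hmin := fun i => Nat.find_min (m := i) hex
    set y := Nat.find hex
    refine ⟨y, by have := hy3 d hd2 hd3; omega, hy1, hy2, hy3, hy4, ?_⟩
    intro q i hq hqi hiy hfi
    by_contra hlt
    by_cases hlarge : ∀ j, j < m → r < f j → j < i
    · have hnot : ¬ ∀ j, j < i → f j ≤ r → f j < f i :=
        fun hall => hmin i hiy ⟨by omega, hfi, hlarge, hall⟩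
      push Not at hnot
      obtain ⟨j, hj1, hj2, hj3⟩ := hnot
      have hne : f j ≠ f i := fun he => by
        have := h.inj j i (by omega) (by omega) he
        omega
      exact h.avoid j i y hj1 hiy hy1 (by omega) (hy4 j (by omega) hj2) (by omega)
    · push Not at hlarge
      obtain ⟨j, hj1, hj2, hj3⟩ := hlarge
      have hne : f j ≠ f q := fun he => by
        have := h.inj j q (by omega) (by omega) he
        omega
      have hne' : i ≠ j := by rintro rfl; omega
      have := hy3 j hj1 hj2
      exact h.avoid q i j hqi (by omega) hj1 (by omega) (by omega) (by omega)
  · push Not at hd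
    have hlow : ∀ i, m - k ≤ i → i < m → r + 1 - k ≤ f i ∧ f i < r + 1 := by
      intro i hi1 hi2
      have h1 := hd i hi1 hi2
      have h2 := h.mem i (by omega)
      refine ⟨?_, by omega⟩
      by_contra hlt
      have := hC.diag_end (f i) (by omega)
      omega
    have hhigh : ∀ i, i < m - k → f i ≤ r → f i + k ≤ r := by
      intro i hi hfi
      by_contra hlt
      obtain ⟨j, hj1, hj2, hj3⟩ := exists_of_mapsTo_Ico (n := m + 1) h.inj (by omega) hlow
        (by omega) (show r + 1 - k ≤ f i by omega) (by omega)
      have := h.inj i j (by omega) (by omega) hj3.symm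
      omega
    have he := hlow (m - k) le_rfl (by omega)
    refine ⟨m - k, le_rfl, by omega, by omega, ?_, ?_, ?_⟩
    · intro i hi hfi
      by_contra hlt
      have := hd i (by omega) hi
      omega
    · intro i hi hfi
      have := hhigh i hi hfi
      omega
    · intro q i _ _ hi hfi
      have := hC.diag_end _ (hhigh i hi hfi)
      omega

theorem IsComark.unique {m r k : ℕ} {b f : ℕ → ℕ} (hC : IsCornerShape m r k b)
    (h : IsCornerOnly m r b f) {y y' : ℕ} (hy : IsComark m r k b f y)
    (hy' : IsComark m r k b f y') : y = y' := by
  wlog hle : y ≤ y' generalizing y y'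
  · exact (this hy' hy (by omega)).symm
  by_contra hne
  obtain ⟨x, y₀, hxy₀, hy₀m, hy₀, hx1, hx2⟩ := h.wit
  obtain ⟨h1, h2, h3, h4, h5, -⟩ := hy
  obtain ⟨h1', h2', h3', h4', h5', h6'⟩ := hy'
  have hfm := h.lt m (by omega)
  obtain ⟨q, hq1, hq2⟩ : ∃ q, q < m ∧ f q = r + 1 := by
    obtain ⟨q, hq, hq'⟩ := exists_eq_of_injOn h.lt h.inj (u := r + 1) (by omega)
    have : q ≠ m := by rintro rfl; omega
    exact ⟨q, by omega, hq'⟩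
  have hqy := h4 q hq1 (by omega)
  have hby := h6' q y hq2 hqy (by omega) h3
  have hdiag := hC.le_add (s := m - y') (by omega)
  have hrow : ∀ u, r - (m - y') ≤ u → u ≤ r → y' < b u := by
    intro u hu1 hu2
    have := hC.mono _ u hu1 (by omega)
    omega
  have hv : f y < r - (m - y') := by
    by_contra hv
    have := hrow (f y) (by omega) h3
    omega
  have := sub_le_sub_of_forall_exists (a := r - (m - y')) (b := r + 1) (c := y') (d := m)
    (f := f) (by
      intro u hu1 hu2
      obtain ⟨j, hj1, hj2⟩ := exists_eq_of_injOn h.lt h.inj (u := u) (by omega)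
      refine ⟨j, ?_, ?_, hj2⟩
      · by_contra hlt
        have hu := hrow u hu1 (by omega)
        by_cases hjy : j < y
        · have := h5 j hjy (by omega)
          omega
        · have hne' : j ≠ y := by rintro rfl; omega
          have := h6' q j hq2 (by omega) (by omega) (by omega)
          rw [hj2] at this
          omega
      · have : j ≠ m := by rintro rfl; omega
        omega)
  omega

theorem isNonsplit_rotate {m r k : ℕ} {b f : ℕ → ℕ} (hC : IsCornerShape m r k b)
    (h : IsCornerOnly m r b f) {y : ℕ} (hM : IsComark m r k b f y) :
    IsNonsplit m r k b (fun i => rotate3 (f m) (r + 1) (f y) (f i)) ∧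
      IsMark m r (fun i => rotate3 (f m) (r + 1) (f y) (f i)) y (f y) ∧
      rotate3 (f m) (r + 1) (f y) (f y) = f m := by
  obtain ⟨x₀, y₀, hxy₀, hy₀m, hy₀, hx1, hx2⟩ := h.wit
  obtain ⟨hge, hym, hyr, hbefore, hmax, hrow⟩ := hM
  have hlt := h.lt
  have hav := h.avoid
  have hav' := h.avoid_last
  have hinj := h.inj
  have hfm := hlt m (by omega)
  have hyb := h.mem y (by omega)
  have hfull : ∀ i j, r ≤ j → j ≤ m → i ≤ m → i < b j := fun i j h1 h2 h3 => by
    rw [hC.full j h1 h2]; omega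
  obtain ⟨q, hqm, hfq⟩ : ∃ q, q < m ∧ f q = r + 1 := by
    obtain ⟨q, hq, hq'⟩ := exists_eq_of_injOn h.lt h.inj (u := r + 1) (by omega)
    have : q ≠ m := by rintro rfl; omega
    exact ⟨q, by omega, hq'⟩
  have hqy := hbefore q hqm (by omega)
  replace hrow := fun i => hrow q i hfq
  set g : ℕ → ℕ := fun i => rotate3 (f m) (r + 1) (f y) (f i) with hg
  have hgm : g m = r + 1 := by simp [hg, rotate3]
  have hgy : g y = f m := by
    simp only [hg, rotate3]
    rw [if_neg (by omega), if_neg (by omega), if_pos trivial]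
  have hgq : g q = f y := by
    simp only [hg, rotate3]
    rw [if_neg (by omega), if_pos hfq]
  have hcase : ∀ i, i ≤ m → (i = m ∧ g i = r + 1) ∨ (i = y ∧ g i = f m) ∨ (i = q ∧ g i = f y) ∨
      (i ≠ m ∧ i ≠ y ∧ i ≠ q ∧ g i = f i ∧ f i ≠ r + 1 ∧ f i ≠ f y ∧ f i ≠ f m) := by
    intro i hi
    by_cases h1 : i = m
    · left; subst h1; exact ⟨rfl, hgm⟩
    by_cases h2 : i = y
    · right; left; subst h2; exact ⟨rfl, hgy⟩
    by_cases h3 : i = q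
    · right; right; left; subst h3; exact ⟨rfl, hgq⟩
    have h4 : f i ≠ f m := fun he => h1 (hinj i m (by omega) (by omega) (by omega))
    have h5 : f i ≠ f y := fun he => h2 (hinj i y (by omega) (by omega) he)
    have h6 : f i ≠ r + 1 := fun he => h3 (hinj i q (by omega) (by omega) (by omega))
    refine Or.inr (Or.inr (Or.inr ⟨h1, h2, h3, ?_, h6, h5, h4⟩))
    simp [hg, rotate3, h4, h5, h6]
  have hglt : ∀ i, i < m + 1 → g i < m + 1 := by
    intro i hi
    have := hlt i hi
    rcases hcase i (by omega) with h1 | h1 | h1 | h1 <;> omega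
  refine ⟨⟨⟨?_, hglt, ?_, ?_, ?_⟩, hgm, ⟨y, hge, hym, by omega⟩⟩,
    ⟨hym, by omega, ?_, hyr, ⟨q, hqy, hgq⟩, ?_⟩, hgy⟩
  · intro i hi
    simp only [hg, rotate3, h.out i hi]
    rw [if_neg (by omega), if_neg (by omega), if_neg (by omega)]
  · intro i j hi hj hij
    exact hinj i j hi hj (rotate3_injective (by omega) (by omega) (by omega) hij)
  · intro i hi
    rcases hcase i (by omega) with ⟨h1, h2⟩ | ⟨h1, h2⟩ | ⟨h1, h2⟩ | ⟨h1, h2, h3, h4, h5⟩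
    · rw [h2]; exact hfull _ _ (by omega) (by omega) (by omega)
    · rw [h2]; exact hfull _ _ (by omega) (by omega) (by omega)
    · rw [h2]; omega
    · rw [h4]; exact h.mem i hi
  · intro x w z hxw hwz hz h1 h2 h3
    have hmx := hmax x
    have hmz := hmax z
    have hrw := hrow w
    rcases hcase w (by omega) with ⟨w1, w2⟩ | ⟨w1, w2⟩ | ⟨w1, w2⟩ | ⟨w0, w1, w2, w3, w4⟩
    · omega
    · have hbz := hbefore z
      rcases hcase z (by omega) with z1 | z1 | z1 | z1 <;> omega
    · subst w1
      rcases hcase x (by omega) with x1 | x1 | x1 | x1 <;> try omega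
      rcases hcase z (by omega) with z1 | z1 | z1 | z1 <;> try omega
      · exact hav' x w (by omega) (by omega) (by omega) (by omega) (by omega)
      · have hbz := hbefore z (by omega)
        exact hav x w z (by omega) (by omega) (by omega) (by omega) (by omega)
          (hfull _ _ (by omega) (by omega) (by omega))
    · rw [w3] at h1 h3
      rcases hcase z (by omega) with z1 | z1 | z1 | z1
      · have hbz : r < g m := by omega
        obtain ⟨rfl, z2⟩ := z1
        by_cases hw : f w < r
        · have := hC.le _ hw
          omega
        · rcases hcase x (by omega) with x1 | x1 | x1 | x1 <;> omega
      · obtain ⟨rfl, z2⟩ := z1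
        rcases hcase x (by omega) with x1 | x1 | x1 | x1 <;> try omega
        by_cases hx : f x < f z
        · exact hav x w z hxw hwz (by omega) (by omega) hx h3
        · by_cases hw : r < f w
          · exact hav' x w hxw (by omega) hw (by omega) (by omega)
          · by_cases hxq : x < q
            · exact hav' x q hxq (by omega) (by omega) (by omega) (by omega)
            · omega
      · obtain ⟨rfl, z2⟩ := z1
        rcases hcase x (by omega) with x1 | x1 | x1 | x1 <;> try omega
        exact hav x w z hxw hwz (by omega) (by omega) (by omega) h3
      · have hbz := hbefore z (by omega)
        rcases hcase x (by omega) with x1 | x1 | x1 | x1 <;> try omega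
        · obtain ⟨rfl, x2⟩ := x1
          by_cases hzy : z < y
          · exact hav x w z hxw hwz (by omega) (by omega) (by omega) h3
          · by_cases hwy : w < y
            · omega
            · exact hav y w z (by omega) hwz (by omega) (by omega) (by omega) h3
        · exact hav x w z hxw hwz (by omega) (by omega) (by omega) h3
  · intro i hi1 hi2
    have := hbefore i hi2
    rcases hcase i (by omega) with i1 | i1 | i1 | i1 <;> omega
  · intro i hi hgi
    have := hmax i hi
    rcases hcase i (by omega) with i1 | i1 | i1 | i1 <;> omega

theorem ncard_isNonsplit {m r k : ℕ} {b : ℕ → ℕ} (hC : IsCornerShape m r k b) :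
    {f | IsNonsplit m r k b f}.ncard = {f | IsCornerOnly m r b f}.ncard := by
  have hex : ∀ f, IsNonsplit m r k b f → ∃ y v, IsMark m r f y v :=
    fun f hf => hf.exists_isMark hC
  choose! y v hyv using hex
  refine Set.ncard_congr (fun f _ => fun i => rotate3 (r + 1) (f (y f)) (v f) (f i)) ?_ ?_ ?_
  · intro f hf
    exact (isCornerOnly_rotate hC hf (hyv f hf)).1
  · intro f f' hf hf' he
    have hM := hyv f hf
    have hM' := hyv f' hf'
    obtain ⟨h1, h2⟩ := isCornerOnly_rotate hC hf hM
    obtain ⟨h1', h2'⟩ := isCornerOnly_rotate hC hf' hM'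
    rw [← he] at h1' h2'
    have hy : y f = y f' := h2.unique hC h1 h2'
    have hm := congrFun he m
    have hyy := congrFun he (y f)
    simp only [rotate3, hf.last, hf'.last, if_true] at hm
    have ha' := hM'.large
    have hb' := hM'.le
    simp only [rotate3] at hyy
    rw [if_neg (by omega), if_pos trivial, hy, if_neg (by omega), if_pos rfl] at hyy
    funext i
    have hi := congrFun he i
    simp only [← hyy, ← hm] at hi
    exact rotate3_injective (by omega) (by omega) (by omega) hi
  · intro g hg
    obtain ⟨x, w, -, -, -, -, hgm⟩ := id hg.wit
    obtain ⟨u, hu⟩ := hg.exists_isComark hC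
    obtain ⟨h1, h2, h3⟩ := isNonsplit_rotate hC hg hu
    refine ⟨_, h1, ?_⟩
    obtain ⟨h4, h5⟩ := (hyv _ h1).unique h2
    have ha := h2.large
    have hb := hu.le
    funext i
    simp only [h4, h5]
    rw [h3] at ha ⊢
    exact rotate3_rotate3 (by omega) (by omega) (by omega) _

/-- Glue an arrangement `α` of the block `[e, m) × [c, c + k)` and an arrangement `β` of the rest,
with the last column `m` in row `c + k`. -/
def glueBlock (m k c e : ℕ) (α β : ℕ → ℕ) (i : ℕ) : ℕ :=
  if i < e then (if β i < c then β i else β i + k + 1)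
  else if i < m then c + α (i - e) else if i = m then c + k else m + 1

/-- Avoiders with the last column in row `r + 1` in which the preceding `k` columns stay below
row `r + 1`. -/
structure IsSplit (m r k : ℕ) (b f : ℕ → ℕ) : Prop where
  av : IsAvoider (m + 1) b f
  last : f m = r + 1
  le : ∀ i, m - k ≤ i → i < m → f i ≤ r

theorem isSplit_glueBlock {m r k : ℕ} {b α β : ℕ → ℕ} (hC : IsCornerShape m r k b)
    (hα : IsAvoider k (fun a => min k (b (r + 1 - k + a) - (m - k))) α)
    (hβ : IsAvoider (m - k) (fun j => min (m - k) (b j)) β) :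
    IsSplit m r k b (glueBlock m k (r + 1 - k) (m - k) α β) := by
  have hr := hC.r_lt
  have hk := hC.k_le
  have hk1 := hC.one_le
  set c := r + 1 - k with hc
  set e := m - k with he
  set g := glueBlock m k c e α β with hg
  have hfull : ∀ i j, r ≤ j → j ≤ m → i ≤ m → i < b j := fun i j h1 h2 h3 => by
    rw [hC.full j h1 h2]; omega
  have hlow : ∀ j, j < c → b j ≤ e := fun j hj => by
    have := hC.diag_end j (by omega)
    omega
  have hgl : ∀ i, i < e → (β i < c ∧ g i = β i) ∨ (c ≤ β i ∧ g i = β i + k + 1) := by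
    intro i hi
    simp only [hg, glueBlock, if_pos hi]
    split_ifs with h1
    · exact Or.inl ⟨h1, rfl⟩
    · exact Or.inr ⟨not_lt.1 h1, rfl⟩
  have hgm : g m = r + 1 := by
    simp only [hg, glueBlock]
    rw [if_neg (by omega), if_neg (by omega), if_pos trivial]
    omega
  have hga : ∀ i, e ≤ i → i < m → g i = c + α (i - e) := by
    intro i h1 h2
    simp only [hg, glueBlock]
    rw [if_neg (by omega), if_pos h2]
  have hαl : ∀ i, e ≤ i → i < m → α (i - e) < k := fun i h1 h2 => hα.lt _ (by omega)
  have hcase : ∀ i, i ≤ m → (i < e ∧ β i < e ∧ β i < c ∧ g i = β i) ∨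
      (i < e ∧ β i < e ∧ c ≤ β i ∧ g i = β i + k + 1) ∨
      (e ≤ i ∧ i < m ∧ α (i - e) < k ∧ g i = c + α (i - e)) ∨ (i = m ∧ g i = r + 1) := by
    intro i hi
    by_cases h1 : i < e
    · have := hβ.lt i h1
      rcases hgl i h1 with h2 | h2
      · exact Or.inl ⟨h1, this, h2⟩
      · exact Or.inr (Or.inl ⟨h1, this, h2⟩)
    · by_cases h2 : i < m
      · exact Or.inr (Or.inr (Or.inl ⟨by omega, h2, hαl i (by omega) h2, hga i (by omega) h2⟩))
      · obtain rfl : i = m := by omega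
        exact Or.inr (Or.inr (Or.inr ⟨rfl, hgm⟩))
  refine ⟨⟨?_, ?_, ?_, ?_, ?_⟩, hgm, ?_⟩
  · intro i hi
    simp only [hg, glueBlock]
    rw [if_neg (by omega), if_neg (by omega), if_neg (by omega)]
  · intro i hi
    rcases hcase i (by omega) with h1 | h1 | h1 | h1 <;> omega
  · intro i j hi hj hij
    have h3 := hα.inj (i - e) (j - e)
    have h4 := hβ.inj i j
    rcases hcase i (by omega) with h1 | h1 | h1 | h1 <;>
      rcases hcase j (by omega) with h2 | h2 | h2 | h2 <;> omega
  · intro i hi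
    rcases hcase i (by omega) with ⟨h1, h2, h3, h4⟩ | ⟨h1, h2, h3, h4⟩ | ⟨h1, h2, h3, h4⟩ | ⟨h1, h2⟩
    · have := hβ.mem i h1
      rw [h4]
      omega
    · rw [h4]
      exact hfull _ _ (by omega) (by omega) (by omega)
    · have := hα.mem (i - e) (by omega)
      rw [h4]
      omega
    · rw [h2]
      exact hfull _ _ (by omega) (by omega) (by omega)
  · intro x w z hxw hwz hz h1 h2 h3
    rcases hcase w (by omega) with ⟨w1, w2, w3, w4⟩ | ⟨w1, w2, w3, w4⟩ | ⟨w1, w2, w3, w4⟩ | w1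
    · rw [w4] at h3
      have h4 := hlow _ w3
      refine hβ.avoid x w z hxw hwz (by omega) ?_ ?_ ?_
      · rcases hcase x (by omega) with x1 | x1 | x1 | x1 <;> omega
      · rcases hcase x (by omega) with x1 | x1 | x1 | x1 <;>
          rcases hcase z (by omega) with z1 | z1 | z1 | z1 <;> omega
      · omega
    · rcases hcase z (by omega) with z1 | z1 | z1 | z1 <;> try omega
      have h5 := hC.mono (r + 1 - k) (β w) w3 (by omega)
      have h6 := hC.le_add (s := k - 1) (by omega)
      rw [show r - (k - 1) = r + 1 - k by omega] at h6
      refine hβ.avoid x w z hxw hwz (by omega) ?_ ?_ ?_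
      · rcases hcase x (by omega) with x1 | x1 | x1 | x1 <;> omega
      · rcases hcase x (by omega) with x1 | x1 | x1 | x1 <;> omega
      · omega
    · rw [w4] at h3
      rcases hcase z (by omega) with z1 | z1 | z1 | z1
      · omega
      · omega
      · rcases hcase x (by omega) with x1 | x1 | x1 | x1 <;> try omega
        refine hα.avoid (x - e) (w - e) (z - e) (by omega) (by omega) (by omega) (by omega)
          (by omega) ?_
        omega
      · have : r ≤ c + α (w - e) := by
          by_contra hlt
          have := hC.le (c + α (w - e)) (by omega)
          omega
        omega
    · omega
  · intro i hi1 hi2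
    rcases hcase i (by omega) with h1 | h1 | h1 | h1 <;> omega

theorem glueBlock_injective {m r k : ℕ} {b b₁ b₂ α β α' β' : ℕ → ℕ}
    (hC : IsCornerShape m r k b) (hα : IsAvoider k b₁ α) (hα' : IsAvoider k b₁ α')
    (hβ : IsAvoider (m - k) b₂ β) (hβ' : IsAvoider (m - k) b₂ β')
    (h : glueBlock m k (r + 1 - k) (m - k) α β = glueBlock m k (r + 1 - k) (m - k) α' β') :
    α = α' ∧ β = β' := by
  have hr := hC.r_lt
  have hk := hC.k_le
  constructor
  · funext a
    by_cases ha : a < k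
    · have := congrFun h (m - k + a)
      simp only [glueBlock] at this
      rw [if_neg (by omega), if_pos (by omega), if_neg (by omega), if_pos (by omega),
        show m - k + a - (m - k) = a by omega] at this
      omega
    · rw [hα.out a (by omega), hα'.out a (by omega)]
  · funext i
    by_cases hi : i < m - k
    · have := congrFun h i
      simp only [glueBlock, if_pos hi] at this
      split_ifs at this <;> omega
    · rw [hβ.out i (by omega), hβ'.out i (by omega)]

theorem IsSplit.exists_glueBlock {m r k : ℕ} {b f : ℕ → ℕ} (hC : IsCornerShape m r k b)
    (h : IsSplit m r k b f) :
    ∃ α β, IsAvoider k (fun a => min k (b (r + 1 - k + a) - (m - k))) α ∧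
      IsAvoider (m - k) (fun j => min (m - k) (b j)) β ∧
      glueBlock m k (r + 1 - k) (m - k) α β = f := by
  have hr := hC.r_lt
  have hk := hC.k_le
  have hk1 := hC.one_le
  have hlast := h.last
  have hle := h.le
  obtain ⟨hout, hlt, hinj, hmem, hav⟩ := h.av
  have hlow : ∀ i, m - k ≤ i → i < m → r + 1 - k ≤ f i ∧ f i < r + 1 := by
    intro i hi1 hi2
    have h1 := hle i hi1 hi2
    have h2 := hmem i (by omega)
    refine ⟨?_, by omega⟩
    by_contra hlt
    have := hC.diag_end (f i) (by omega)
    omega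
  have hhigh : ∀ i, i < m - k → f i < m + 1 ∧ (f i < r + 1 - k ∨ r + 1 < f i) := by
    intro i hi
    have := hlt i (by omega)
    refine ⟨this, ?_⟩
    by_contra hno
    have h1 : f i ≠ r + 1 := fun he => by
      have := hinj i m (by omega) (by omega) (by omega)
      omega
    obtain ⟨j, hj1, hj2, hj3⟩ := exists_of_mapsTo_Ico (n := m + 1) hinj (by omega) hlow
      (by omega) (show r + 1 - k ≤ f i by omega) (by omega)
    have := hinj i j (by omega) (by omega) hj3.symm
    omega
  set c := r + 1 - k with hc
  set e := m - k with he
  set β : ℕ → ℕ := fun i => if i < e then (if f i < c then f i else f i - (k + 1)) else e with hβ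
  set α : ℕ → ℕ := fun a => if a < k then f (e + a) - c else k with hα
  have hβi : ∀ i, i < e → (f i < c ∧ β i = f i) ∨ (r + 1 < f i ∧ f i < m + 1 ∧
      β i + (k + 1) = f i) := by
    intro i hi
    have := hhigh i hi
    simp only [hβ, if_pos hi]
    split_ifs with h1 <;> omega
  have hαi : ∀ a, a < k → α a + c = f (e + a) ∧ α a < k := by
    intro a ha
    have := hlow (e + a) (by omega) (by omega)
    simp only [hα, if_pos ha]
    omega
  refine ⟨α, β, ⟨?_, fun a ha => (hαi a ha).2, ?_, ?_, ?_⟩, ⟨?_, ?_, ?_, ?_, ?_⟩, ?_⟩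
  · intro a ha
    simp only [hα]
    rw [if_neg (by omega)]
  · intro i j hi hj hij
    have h1 := hαi i hi
    have h2 := hαi j hj
    have := hinj (e + i) (e + j) (by omega) (by omega) (by omega)
    omega
  · intro a ha
    have h1 := hαi a ha
    have h2 := hmem (e + a) (by omega)
    rw [← h1.1] at h2
    rw [add_comm c]
    omega
  · intro x w z hxw hwz hz h1 h2 h3
    have hx := hαi x (by omega)
    have hw := hαi w (by omega)
    have hz' := hαi z (by omega)
    refine hav (e + x) (e + w) (e + z) (by omega) (by omega) (by omega) (by omega) (by omega) ?_
    rw [← hw.1, add_comm _ c]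
    omega
  · intro a ha
    simp only [hβ]
    rw [if_neg (by omega)]
  · intro i hi
    rcases hβi i hi with h1 | h1 <;> omega
  · intro i j hi hj hij
    apply hinj i j (by omega) (by omega)
    rcases hβi i hi with h1 | h1 <;> rcases hβi j hj with h2 | h2 <;> omega
  · intro i hi
    have h6 := hC.le_add (s := k - 1) (by omega)
    rw [show r - (k - 1) = r + 1 - k by omega] at h6
    rcases hβi i hi with h1 | h1
    · have := hmem i (by omega)
      rw [h1.2]
      omega
    · have h5 := hC.mono (r + 1 - k) (β i) (by omega) (by omega)
      omega
  · intro x w z hxw hwz hz h1 h2 h3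
    have hz' := hβi z hz
    have hw := hβi w (by omega)
    have hx := hβi x (by omega)
    refine hav x w z hxw hwz (by omega) (by omega) (by omega) ?_
    rcases hw with hw | hw
    · rw [← hw.2]
      omega
    · rw [hC.full (f w) (by omega) (by omega)]
      omega
  · funext i
    simp only [glueBlock]
    split_ifs with h1 h2 h3 h4
    · have := hβi i h1
      omega
    · have := hβi i h1
      omega
    · have := hαi (i - e) (by omega)
      rw [show e + (i - e) = i by omega] at this
      omega
    · subst h4
      omega
    · rw [hout i (by omega)]

theorem ncard_isSplit {m r k : ℕ} {b : ℕ → ℕ} (hC : IsCornerShape m r k b) :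
    {f | IsSplit m r k b f}.ncard =
      {f | IsAvoider k (fun a => min k (b (r + 1 - k + a) - (m - k))) f}.ncard *
        {f | IsAvoider (m - k) (fun j => min (m - k) (b j)) f}.ncard := by
  rw [← Set.ncard_prod]
  symm
  refine Set.ncard_congr
    (fun p _ => glueBlock m k (r + 1 - k) (m - k) p.1 p.2) ?_ ?_ ?_
  · rintro ⟨α, β⟩ ⟨hα, hβ⟩
    exact isSplit_glueBlock hC hα hβ
  · rintro ⟨α, β⟩ ⟨α', β'⟩ ⟨hα : IsAvoider k _ α, hβ : IsAvoider _ _ β⟩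
      ⟨hα' : IsAvoider k _ α', hβ' : IsAvoider _ _ β'⟩ h
    obtain ⟨rfl, rfl⟩ := glueBlock_injective hC hα hα' hβ hβ' h
    rfl
  · intro f hf
    obtain ⟨α, β, hα, hβ, h⟩ := IsSplit.exists_glueBlock hC hf
    exact ⟨(α, β), ⟨hα, hβ⟩, h⟩

theorem IsAvoider.swap_rows {m r k : ℕ} {b f : ℕ → ℕ} (hC : IsCornerShape m r k b)
    (h : IsAvoider (m + 1) b f) (hf : f m = r ∨ f m = r + 1) :
    IsAvoider (m + 1) b (fun i => Equiv.swap r (r + 1) (f i)) := by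
  have hr := hC.r_lt
  obtain ⟨hout, hlt, hinj, hmem, hav⟩ := h
  set g : ℕ → ℕ := fun i => Equiv.swap r (r + 1) (f i) with hg
  have hcase : ∀ i, (f i = r ∧ g i = r + 1) ∨ (f i = r + 1 ∧ g i = r) ∨
      (f i ≠ r ∧ f i ≠ r + 1 ∧ g i = f i) := by
    intro i
    simp only [hg, Equiv.swap_apply_def]
    split_ifs <;> omega
  have hrow : ∀ i, i < m + 1 → b (g i) = b (f i) := by
    intro i hi
    rcases hcase i with h1 | h1 | h1
    · rw [hC.full _ (by omega) (by omega), hC.full _ (by omega) (by omega)]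
    · rw [hC.full _ (by omega) (by omega), hC.full _ (by omega) (by omega)]
    · rw [h1.2.2]
  refine ⟨?_, ?_, ?_, ?_, ?_⟩
  · intro i hi
    have := hout i hi
    have := hcase i
    omega
  · intro i hi
    have := hlt i hi
    have := hcase i
    omega
  · intro i j hi hj hij
    exact hinj i j hi hj ((Equiv.swap r (r + 1)).injective hij)
  · intro i hi
    rw [hrow i hi]
    exact hmem i hi
  · intro x w z hxw hwz hz h1 h2 h3
    rw [hrow w (by omega)] at h3
    have hxm : f x ≠ f m := fun he => by
      have := hinj x m (by omega) (by omega) he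
      omega
    have hwm : f w ≠ f m := fun he => by
      have := hinj w m (by omega) (by omega) he
      omega
    have hxw' : f x ≠ f w := fun he => by
      have := hinj x w (by omega) (by omega) he
      omega
    have cx := hcase x
    have cw := hcase w
    have cz := hcase z
    by_cases hzm : z = m
    · subst hzm
      by_cases hw : f w < r
      · have := hC.le _ hw
        omega
      · omega
    · have hzm : f z ≠ f m := fun he => hzm (hinj z m (by omega) (by omega) he)
      exact hav x w z hxw hwz hz (by omega) (by omega) h3

theorem ncard_isAvoider_last {m r k : ℕ} {b : ℕ → ℕ} (hC : IsCornerShape m r k b) :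
    {f | IsAvoider (m + 1) b f ∧ f m = r}.ncard =
      {f | IsAvoider (m + 1) b f ∧ f m = r + 1}.ncard := by
  refine Set.ncard_congr (fun f _ => fun i => Equiv.swap r (r + 1) (f i)) ?_ ?_ ?_
  · rintro f ⟨hf, hm⟩
    exact ⟨hf.swap_rows hC (Or.inl hm), by simp [hm]⟩
  · intro f g _ _ h
    funext i
    exact (Equiv.swap r (r + 1)).injective (congrFun h i)
  · rintro f ⟨hf, hm⟩
    refine ⟨fun i => Equiv.swap r (r + 1) (f i), ⟨hf.swap_rows hC (Or.inr hm), by simp [hm]⟩, ?_⟩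
    funext i
    simp

/-- Column decomposition in terms of `IsAvoider` functions. -/
theorem ncard_isAvoider_corner {m r k : ℕ} {b b' : ℕ → ℕ} (hC : IsCornerShape m r k b)
    (hb' : ∀ j, b' j = if j = r then m else b j)
    (hmono' : ∀ i j : ℕ, i ≤ j → j < m + 1 → b' i ≤ b' j) :
    {f | IsAvoider (m + 1) b f}.ncard = {f | IsAvoider (m + 1) b' f}.ncard +
      {f | IsAvoider k (fun a => min k (b (r + 1 - k + a) - (m - k))) f}.ncard *
        {f | IsAvoider (m - k) (fun j => min (m - k) (b j)) f}.ncard := by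
  have hr := hC.r_lt
  have hfin := finite_isAvoider hC.mono
  have hfin' := finite_isAvoider hmono'
  have hge : ∀ f, IsAvoider (m + 1) b f → r ≤ f m := fun f hf => by
    by_contra hlt
    have := hC.le (f m) (by omega)
    have := hf.mem m (by omega)
    omega
  have h1 : {f | IsAvoider (m + 1) b f} = {f | IsAvoider (m + 1) b f ∧ f m = r} ∪
      {f | IsAvoider (m + 1) b f ∧ r < f m} := by
    ext f
    simp only [Set.mem_ofPred_eq, Set.mem_union, ← and_or_left]
    refine ⟨fun hf => ⟨hf, ?_⟩, fun hf => hf.1⟩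
    have := hge f hf
    omega
  have h2 : {f | IsAvoider (m + 1) b' f} = {f | IsCornerOnly m r b f} ∪
      {f | IsAvoider (m + 1) b f ∧ r < f m} := by
    ext f
    simp only [Set.mem_ofPred_eq, Set.mem_union, isCornerOnly_iff hC hb']
    constructor
    · intro hf
      by_cases hfb : IsAvoider (m + 1) b f
      · have h3 := hge f hfb
        have h4 := hf.mem m (by omega)
        rw [hb'] at h4
        split_ifs at h4 with h5
        · omega
        · exact Or.inr ⟨hfb, by omega⟩
      · exact Or.inl ⟨hf, hfb⟩
    · rintro (hf | ⟨hf, hm⟩)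
      · exact hf.1
      · refine ⟨hf.out, hf.lt, hf.inj, ?_, ?_⟩
        · intro i hi
          rw [hb']
          split_ifs with h5
          · have : i ≠ m := by rintro rfl; omega
            omega
          · exact hf.mem i hi
        · intro x w z h3 h4 h5 h6 h7 h8
          refine hf.avoid x w z h3 h4 h5 h6 h7 ?_
          rw [hb'] at h8
          split_ifs at h8 with h9
          · rw [h9, hC.full r le_rfl hr.le]
            omega
          · exact h8
  have h3 : {f | IsAvoider (m + 1) b f ∧ f m = r + 1} =
      {f | IsSplit m r k b f} ∪ {f | IsNonsplit m r k b f} := by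
    ext f
    constructor
    · rintro ⟨hf, hm⟩
      by_cases hs : ∀ i, m - k ≤ i → i < m → f i ≤ r
      · exact Or.inl ⟨hf, hm, hs⟩
      · push Not at hs
        obtain ⟨i, hi1, hi2, hi3⟩ := hs
        refine Or.inr ⟨hf, hm, i, hi1, hi2, ?_⟩
        have : f i ≠ f m := fun he => by
          have := hf.inj i m (by omega) (by omega) he
          omega
        omega
    · rintro (hf | hf)
      · exact ⟨hf.av, hf.last⟩
      · exact ⟨hf.av, hf.last⟩
  have d1 : {f | IsAvoider (m + 1) b f}.ncard = {f | IsAvoider (m + 1) b f ∧ f m = r}.ncard +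
      {f | IsAvoider (m + 1) b f ∧ r < f m}.ncard := by
    rw [h1]
    refine Set.ncard_union_eq ?_ (hfin.subset fun f hf => hf.1) (hfin.subset fun f hf => hf.1)
    rw [Set.disjoint_left]
    rintro f ⟨-, hf⟩ ⟨-, hf'⟩
    omega
  have d2 : {f | IsAvoider (m + 1) b' f}.ncard = {f | IsCornerOnly m r b f}.ncard +
      {f | IsAvoider (m + 1) b f ∧ r < f m}.ncard := by
    rw [h2]
    refine Set.ncard_union_eq ?_ (hfin'.subset fun f hf => ((isCornerOnly_iff hC hb').1 hf).1)
      (hfin.subset fun f hf => hf.1)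
    rw [Set.disjoint_left]
    rintro f hf ⟨hf', -⟩
    exact ((isCornerOnly_iff hC hb').1 hf).2 hf'
  have d3 : {f | IsAvoider (m + 1) b f ∧ f m = r + 1}.ncard =
      {f | IsSplit m r k b f}.ncard + {f | IsNonsplit m r k b f}.ncard := by
    rw [h3]
    refine Set.ncard_union_eq ?_ (hfin.subset fun f hf => hf.av) (hfin.subset fun f hf => hf.av)
    rw [Set.disjoint_left]
    intro f hf hf'
    obtain ⟨i, hi1, hi2, hi3⟩ := hf'.ex
    have := hf.le i hi1 hi2
    omega
  rw [d1, d2, ncard_isAvoider_last hC, d3, ncard_isSplit hC, ncard_isNonsplit hC]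
  ring

theorem card_filter_lt_iff {n t p : ℕ} {b : ℕ → ℕ}
    (hb : ∀ i j : ℕ, i ≤ j → j < n → b i ≤ b j) (hp : p < n) :
    p < ((Finset.range n).filter (fun i => t < b i)).card ↔ t < b (n - 1 - p) := by
  constructor
  · intro h
    by_contra hlt
    have hsub : (Finset.range n).filter (fun i => t < b i) ⊆ Finset.Ico (n - p) n := by
      intro i hi
      simp only [Finset.mem_filter, Finset.mem_range, Finset.mem_Ico] at hi ⊢
      refine ⟨?_, hi.1⟩
      by_contra hi'
      have := hb i (n - 1 - p) (by omega) (by omega)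
      omega
    have := Finset.card_le_card hsub
    rw [Nat.card_Ico] at this
    omega
  · intro h
    have hsub : Finset.Ico (n - 1 - p) n ⊆ (Finset.range n).filter (fun i => t < b i) := by
      intro i hi
      simp only [Finset.mem_filter, Finset.mem_range, Finset.mem_Ico] at hi ⊢
      have := hb (n - 1 - p) i hi.1 hi.2
      omega
    have := Finset.card_le_card hsub
    rw [Nat.card_Ico] at this
    omega

theorem card_filter_le_add (N d B : ℕ) :
    ((Finset.range N).filter (fun i => d < B + i)).card = min N (N + B - (d + 1)) := by
  have : (Finset.range N).filter (fun i => d < B + i) = Finset.Ico (d + 1 - B) N := by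
    ext i
    simp only [Finset.mem_filter, Finset.mem_range, Finset.mem_Ico]
    omega
  rw [this, Nat.card_Ico]
  omega

theorem lt_transposeShape_iff {m j p : ℕ} {b : ℕ → ℕ}
    (hb : ∀ i j : ℕ, i ≤ j → j < m + 1 → b i ≤ b j) (hp : p < m + 1) :
    p < transposeShape (m + 1) b j ↔ m - j < b (m - p) :=
  card_filter_lt_iff hb hp

theorem isCornerShape_ccRow {m : ℕ} {b : ℕ → ℕ} (hY : IsYoungShape (m + 1) b)
    (hcol : 2 ≤ transposeShape (m + 1) b 0) :
    transposeShape (m + 1) b 0 = m + 1 - ccRow (m + 1) b ∧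
      IsCornerShape m (ccRow (m + 1) b)
        (rdK (m + 1) (transposeShape (m + 1) b) (transposeShape (m + 1) b 0 - 2)) b := by
  obtain ⟨hmono, hst⟩ := hY
  have hne : {i : ℕ | m + 1 ≤ b i}.Nonempty := ⟨m, by have := hst m (by omega); exact this.1⟩
  have hrspec : m + 1 ≤ b (ccRow (m + 1) b) := Nat.sInf_mem hne
  have hrmin : ∀ i, i < ccRow (m + 1) b → ¬ m + 1 ≤ b i := fun i hi h =>
    Nat.notMem_of_lt_sInf (s := {i : ℕ | m + 1 ≤ b i}) hi h
  have hrm : ccRow (m + 1) b ≤ m := by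
    by_contra hlt
    have := hrmin m (by omega)
    have := hst m (by omega)
    omega
  set r := ccRow (m + 1) b with hr
  have hle : transposeShape (m + 1) b 0 ≤ m + 1 :=
    (Finset.card_filter_le _ _).trans (by simp)
  have h0 : transposeShape (m + 1) b 0 = m + 1 - r := by
    apply le_antisymm
    · by_contra hlt
      have h1 := (lt_transposeShape_iff hmono (j := 0) (p := m + 1 - r) (by omega)).1 (by omega)
      have h2 := hrmin (m - (m + 1 - r)) (by omega)
      omega
    · have h1 := (lt_transposeShape_iff hmono (j := 0) (p := m - r) (by omega)).2
        (by rw [show m - (m - r) = r by omega]; omega)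
      omega
  refine ⟨h0, ?_⟩
  set bt := transposeShape (m + 1) b with hbt
  have hbtle : ∀ j, bt j ≤ m + 1 := fun j => (Finset.card_filter_le _ _).trans (by simp)
  have hbt1 : m - r < bt 1 := by
    rw [hbt, lt_transposeShape_iff hmono (by omega), show m - (m - r) = r by omega]
    omega
  have hmem : r + 1 ∈ {s : ℕ | (s = 0 ∧ (m + 1 ≤ 1 ∨ bt 1 ≤ bt 0 - 2 + 1)) ∨
      (1 ≤ s ∧ bt s ≤ bt 0 - 2 + s + 1)} := by
    refine Or.inr ⟨by omega, ?_⟩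
    have := hbtle (r + 1)
    omega
  have hkle : rdK (m + 1) bt (bt 0 - 2) ≤ r + 1 := Nat.sInf_le hmem
  have hkmem : (rdK (m + 1) bt (bt 0 - 2) = 0 ∧ (m + 1 ≤ 1 ∨ bt 1 ≤ bt 0 - 2 + 1)) ∨
      (1 ≤ rdK (m + 1) bt (bt 0 - 2) ∧
        bt (rdK (m + 1) bt (bt 0 - 2)) ≤ bt 0 - 2 + rdK (m + 1) bt (bt 0 - 2) + 1) :=
    Nat.sInf_mem ⟨_, hmem⟩
  have hkmin : ∀ s, s < rdK (m + 1) bt (bt 0 - 2) → 1 ≤ s → ¬ bt s ≤ bt 0 - 2 + s + 1 :=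
    fun s hs h1 h2 => Nat.notMem_of_lt_sInf hs (Or.inr ⟨h1, h2⟩)
  set k := rdK (m + 1) bt (bt 0 - 2) with hk
  refine ⟨hmono, by omega, ?_, ?_, by omega, hkle, ?_, ?_⟩
  · intro j hj hjm
    have h1 := hmono r j hj (by omega)
    have h2 := hst j (by omega)
    omega
  · intro j hj
    have := hrmin j hj
    omega
  · intro s hs1 hs2
    have h1 := hkmin s hs2 hs1
    have h2 := (lt_transposeShape_iff hmono (j := s) (p := m - r + s) (by omega)).1
      (by rw [← hbt]; omega)
    rw [show m - (m - r + s) = r - s by omega] at h2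
    omega
  · intro j hj
    by_contra hlt
    have h1 := hmono j (r - k) (by omega) (by omega)
    have h2 := (lt_transposeShape_iff hmono (j := k) (p := m - r + k) (by omega)).2
      (by rw [show m - (m - r + k) = r - k by omega]; omega)
    rw [← hbt] at h2
    omega

theorem transposeShape_rdA {m r k a : ℕ} {b : ℕ → ℕ} (hC : IsCornerShape m r k b)
    (h0 : transposeShape (m + 1) b 0 = m + 1 - r)
    (hk : rdK (m + 1) (transposeShape (m + 1) b) (transposeShape (m + 1) b 0 - 2) = k)
    (ha : a < k) :
    transposeShape k (rdA (m + 1) (transposeShape (m + 1) b)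
      (transposeShape (m + 1) b 0 - 2)) a = min k (b (r + 1 - k + a) - (m - k)) := by
  have hr := hC.r_lt
  have hkr := hC.k_le
  have hmono := hC.mono
  have hrow : m + 1 ≤ b (r + 1 - k + a) + k := by
    have h1 := hC.le_add (s := k - 1) (by omega)
    rw [show r - (k - 1) = r + 1 - k by omega] at h1
    have h2 := hmono (r + 1 - k) (r + 1 - k + a) (by omega) (by omega)
    omega
  have hfilter : ∀ i, i < k → (k - 1 - a < rdA (m + 1) (transposeShape (m + 1) b)
      (transposeShape (m + 1) b 0 - 2) i ↔ m - 1 < b (r + 1 - k + a) + i) := by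
    intro i hi
    have h1 := lt_transposeShape_iff hmono (j := i + 1) (p := m - r + k - 1 - a) (by omega)
    rw [show m - (m - r + k - 1 - a) = r + 1 - k + a by omega] at h1
    rw [rdA, hk, h0, lt_min_iff]
    omega
  rw [transposeShape, Finset.filter_congr fun i hi => hfilter i (Finset.mem_range.1 hi),
    card_filter_le_add]
  omega

theorem transposeShape_rdB {m r k j : ℕ} {b : ℕ → ℕ} (hC : IsCornerShape m r k b)
    (hk : rdK (m + 1) (transposeShape (m + 1) b) (transposeShape (m + 1) b 0 - 2) = k)
    (hj : j < m - k) :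
    transposeShape (m - k) (rdB (m + 1) (transposeShape (m + 1) b)
      (transposeShape (m + 1) b 0 - 2)) j = min (m - k) (b j) := by
  have hmono := hC.mono
  have hfilter : ∀ i, i < m - k → (m - k - 1 - j < rdB (m + 1) (transposeShape (m + 1) b)
      (transposeShape (m + 1) b 0 - 2) i ↔ m - (k + 1) < b j + i) := by
    intro i hi
    have h1 := lt_transposeShape_iff hmono (j := k + 1 + i) (p := m - j) (by omega)
    rw [show m - (m - j) = j by omega] at h1
    rw [rdB, hk]
    omega
  rw [transposeShape, Finset.filter_congr fun i hi => hfilter i (Finset.mem_range.1 hi),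
    card_filter_le_add]
  omega

/-- Column decomposition: `T(Y) = T(Y'_c) + T(Y''_c)` for every Young diagram `Y`
(whose rightmost column has at least two cells, so that the cell `C_{t-1}` directly
above the right corner exists). -/
theorem column_decomposition (n : ℕ) (b : ℕ → ℕ) (hY : IsYoungShape n b)
    (hcol : 2 ≤ transposeShape n b 0) :
    T n b = T n (colDel n b) + cdTermT n b := by
  obtain _ | m := n
  · simp [transposeShape] at hcol
  obtain ⟨h0, hC⟩ := isCornerShape_ccRow hY hcol
  have hkr := hC.k_le
  have hmono' : ∀ i j : ℕ, i ≤ j → j < m + 1 → colDel (m + 1) b i ≤ colDel (m + 1) b j := by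
    intro i j hij hj
    have h1 := hC.mono i j hij hj
    have h2 := hC.le i
    have h3 := hC.full j
    simp only [colDel]
    split_ifs <;> omega
  rw [cdTermT, T_eq_ncard hC.mono, T_eq_ncard hmono',
    ncard_isAvoider_corner (b' := colDel (m + 1) b) hC (fun j => rfl) hmono']
  generalize hk : rdK (m + 1) (transposeShape (m + 1) b)
    (transposeShape (m + 1) b 0 - 2) = k at *
  generalize ccRow (m + 1) b = r at *
  rw [show m + 1 - 1 - k = m - k by omega]
  rw [T_congr fun a ha => transposeShape_rdA hC h0 hk ha,
    T_congr fun j hj => transposeShape_rdB hC hk hj, T_eq_ncard, T_eq_ncard]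
  · intro i j hij hj
    have := hC.mono i j hij (by omega)
    omega
  · intro i j hij hj
    have := hC.mono (r + 1 - k + i) (r + 1 - k + j) (by omega) (by omega)
    omega
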